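/- arXiv:0709.3016 — 5 statements merged into one kernel-verified Lean document; each statement's English description precedes it below -/
import Mathlib

section
/- For every sequence (S_n)_{n∈ω} of v⁰-sets and every segment ⟨A,B⟩ there exists a segment ⟨E,F⟩ ⊆ ⟨A,B⟩ such that S_n ∩ ⟨E,F⟩ = ∅ for every n ∈ ω. -/
open Set

/-- `A`, `B` form a segment when `A ⊆ B` and `B \ A` is infinite. -/
def IsSeg (A B : Set ℕ) : Prop := A ⊆ B ∧ (B \ A).Infinite

/-- The segment `⟨A,B⟩ = {X ∈ [ω]^ω : A ⊆ X ⊆ B}`. -/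
def Seg (A B : Set ℕ) : Set (Set ℕ) := {X | X.Infinite ∧ A ⊆ X ∧ X ⊆ B}

/-- `X ⊆* Y` : the set `X \ Y` is finite. -/
def AlmostSub (X Y : Set ℕ) : Prop := (X \ Y).Finite

/-- The *-segment `⟨A,B⟩* = {X ∈ [ω]^ω : A ⊆* X ⊆* B}`. -/
def StarSeg (A B : Set ℕ) : Set (Set ℕ) := {X | X.Infinite ∧ AlmostSub A X ∧ AlmostSub X B}

/-- `S` is a v⁰-set: every segment contains a segment disjoint from `S`. -/
def IsVZero (S : Set (Set ℕ)) : Prop :=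
  ∀ A B, IsSeg A B → ∃ C D, IsSeg C D ∧ Seg C D ⊆ Seg A B ∧ Seg C D ∩ S = ∅

/-- `S` is a v-set: every segment contains a segment inside `S` or disjoint from `S`. -/
def IsVSet (S : Set (Set ℕ)) : Prop :=
  ∀ A B, IsSeg A B → ∃ C D, IsSeg C D ∧ Seg C D ⊆ Seg A B ∧
    (Seg C D ⊆ S ∨ Seg C D ∩ S = ∅)

theorem IsSeg.subset_of_seg_subset {A B C D : Set ℕ} (h : IsSeg C D)
    (hsub : Seg C D ⊆ Seg A B) : A ⊆ C ∧ D ⊆ B := by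
  obtain ⟨hCD, hinf⟩ := h
  have hD : D ∈ Seg C D := ⟨hinf.mono sdiff_subset, hCD, subset_rfl⟩
  refine ⟨fun a ha => ?_, (hsub hD).2.2⟩
  by_contra haC
  have hX : D \ {a} ∈ Seg C D := by
    refine ⟨(hinf.sdiff (finite_singleton a)).mono ?_, ?_, sdiff_subset⟩
    · exact sdiff_subset_sdiff_left sdiff_subset
    · exact subset_sdiff_singleton hCD haC
  exact ((hsub hX).2.1 ha).2 rfl

/-- A segment can be shrunk to avoid a v⁰-set while keeping finitely many coordinates free. -/
theorem IsVZero.exists_seg_disjoint {S : Set (Set ℕ)} (hS : IsVZero S) (K : Finset ℕ) :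
    ∀ A B, IsSeg A B → ↑K ⊆ B \ A → ∃ C D, IsSeg C D ∧ A ⊆ C ∧ D ⊆ B ∧ ↑K ⊆ D \ C ∧
      Disjoint (Seg C D) S := by
  induction K using Finset.induction_on with
  | empty =>
    intro A B h _
    obtain ⟨C, D, hCD, hsub, hdisj⟩ := hS A B h
    obtain ⟨hAC, hDB⟩ := hCD.subset_of_seg_subset hsub
    exact ⟨C, D, hCD, hAC, hDB, by simp, disjoint_iff_inter_eq_empty.2 hdisj⟩
  | insert p K hp ih =>
    intro A B h hK
    have hpB : p ∈ B \ A := hK (by simp)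
    obtain ⟨C, D, hCD, hAC, hDB, hKCD, hdisj⟩ := ih (insert p A) B
      ⟨insert_subset hpB.1 h.1,
        (h.2.sdiff (finite_singleton p)).mono fun x hx => by
          simp only [mem_sdiff, mem_insert_iff, mem_singleton_iff] at hx ⊢; tauto⟩
      (fun x hx => by
        have := hK (Finset.mem_coe.2 (Finset.mem_insert_of_mem hx))
        refine ⟨this.1, ?_⟩
        rintro (rfl | hxA)
        · exact hp hx
        · exact this.2 hxA)
    have hpC : p ∈ C := hAC (mem_insert p A)
    have hdiff : (D \ {p}) \ (C \ {p}) = D \ C := by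
      ext x
      simp only [mem_sdiff, mem_singleton_iff]
      grind
    obtain ⟨C', D', hCD', hCC', hDD', hKCD', hdisj'⟩ := ih (C \ {p}) (D \ {p})
      ⟨sdiff_subset_sdiff_left hCD.1, hdiff ▸ hCD.2⟩ (hdiff ▸ hKCD)
    have hpC' : p ∉ C' := fun hp' => (hDD' (hCD'.1 hp')).2 rfl
    refine ⟨C', insert p D', ⟨hCD'.1.trans (subset_insert p D'),
      hCD'.2.mono (sdiff_subset_sdiff_left (subset_insert p D'))⟩,
      fun x hx => hCC' ⟨hAC (.inr hx), ?_⟩,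
      insert_subset hpB.1 (hDD'.trans (sdiff_subset.trans hDB)), ?_, ?_⟩
    · rintro rfl
      exact hpB.2 hx
    · rw [Finset.coe_insert]
      exact insert_subset ⟨mem_insert p D', hpC'⟩
        (hKCD'.trans (sdiff_subset_sdiff_left (subset_insert p D')))
    · refine disjoint_left.2 fun X hX => ?_
      obtain ⟨hXinf, hCX, hXD⟩ := hX
      by_cases hpX : p ∈ X
      · refine disjoint_left.1 hdisj ⟨hXinf, fun x hx => ?_, hXD.trans ?_⟩
        · by_cases hxp : x = p
          · exact hxp ▸ hpX
          · exact hCX (hCC' ⟨hx, hxp⟩)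
        · exact insert_subset (hCD.1 hpC) (hDD'.trans sdiff_subset)
      · exact disjoint_left.1 hdisj' ⟨hXinf, hCX, (subset_insert_iff_of_notMem hpX).1 hXD⟩

/-- Lemma 4: countably many v⁰-sets can be avoided by a single subsegment. -/
theorem seq_vZero_avoided_by_segment (S : ℕ → Set (Set ℕ)) (hS : ∀ n, IsVZero (S n))
    (A B : Set ℕ) (h : IsSeg A B) :
    ∃ E F, IsSeg E F ∧ Seg E F ⊆ Seg A B ∧ ∀ n, S n ∩ Seg E F = ∅ := by
  let State := {t : Set ℕ × Set ℕ × Finset ℕ // IsSeg t.1 t.2.1 ∧ ↑t.2.2 ⊆ t.2.1 \ t.1}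
  have step : ∀ (n : ℕ) (t : State), ∃ u : State, t.1.1 ⊆ u.1.1 ∧ u.1.2.1 ⊆ t.1.2.1 ∧
      t.1.2.2 ⊂ u.1.2.2 ∧ Disjoint (Seg u.1.1 u.1.2.1) (S n) := by
    rintro n ⟨⟨A, B, K⟩, hAB, hK⟩
    obtain ⟨C, D, hCD, hAC, hDB, hKCD, hdisj⟩ := (hS n).exists_seg_disjoint K A B hAB hK
    obtain ⟨p, hp, hpK⟩ := hCD.2.exists_notMem_finset K
    refine ⟨⟨(C, D, insert p K), hCD, ?_⟩, hAC, hDB, Finset.ssubset_insert hpK, hdisj⟩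
    simpa only [Finset.coe_insert] using insert_subset hp hKCD
  choose next hA hB hK hdisj using step
  let t : ℕ → State := fun n => Nat.rec ⟨(A, B, ∅), h, by simp⟩ next n
  have hAmono : Monotone fun n => (t n).1.1 := monotone_nat_of_le_succ fun n => hA n (t n)
  have hBanti : Antitone fun n => (t n).1.2.1 := antitone_nat_of_succ_le fun n => hB n (t n)
  have hKmono : StrictMono fun n => (t n).1.2.2 := strictMono_nat_of_lt_succ fun n => hK n (t n)
  have hmem : ∀ i j, ↑(t i).1.2.2 ⊆ (t j).1.2.1 \ (t j).1.1 := fun i j x hx => by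
    have hx' := (t (max i j)).2.2 (hKmono.monotone (le_max_left i j) hx)
    exact ⟨hBanti (le_max_right i j) hx'.1, fun hxA => hx'.2 (hAmono (le_max_right i j) hxA)⟩
  refine ⟨⋃ n, (t n).1.1, ⋂ n, (t n).1.2.1, ⟨?_, ?_⟩, ?_, fun n => ?_⟩
  · refine iUnion_subset fun i => subset_iInter fun j => ?_
    exact (hAmono (le_max_left i j)).trans
      ((t (max i j)).2.1.1.trans (hBanti (le_max_right i j)))
  · have hsub : ∀ i, ↑(t i).1.2.2 ⊆ (⋂ n, (t n).1.2.1) \ ⋃ n, (t n).1.1 := fun i x hx =>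
      ⟨mem_iInter.2 fun j => (hmem i j hx).1, fun hxA => by
        obtain ⟨j, hj⟩ := mem_iUnion.1 hxA
        exact (hmem i j hx).2 hj⟩
    refine (infinite_iUnion (s := fun n => (↑(t n).1.2.2 : Set ℕ)) ?_).mono (iUnion_subset hsub)
    exact Finset.coe_injective.comp hKmono.injective
  · rintro X ⟨hX, hEX, hXF⟩
    exact ⟨hX, (subset_iUnion (fun n => (t n).1.1) 0).trans hEX,
      hXF.trans (iInter_subset (fun n => (t n).1.2.1) 0)⟩
  · refine disjoint_iff_inter_eq_empty.1 (disjoint_right.2 ?_)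
    rintro X ⟨hX, hEX, hXF⟩
    exact disjoint_left.1 (hdisj n (t n)) ⟨hX,
      (subset_iUnion (fun n => (t n).1.1) (n + 1)).trans hEX,
      hXF.trans (iInter_subset (fun n => (t n).1.2.1) (n + 1))⟩
end

section
/- The family (v⁰) is a σ-ideal on [ω]^ω: every subset of a v⁰-set is a v⁰-set, the union of countably many v⁰-sets is a v⁰-set, and [ω]^ω itself is not a v⁰-set. -/
open Set

lemma Seg_mono {A B C D : Set ℕ} (hAC : A ⊆ C) (hDB : D ⊆ B) : Seg C D ⊆ Seg A B :=
  fun _ ⟨hX, hC, hD⟩ => ⟨hX, hAC.trans hC, hD.trans hDB⟩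

lemma IsSeg.subset_of_Seg_subset {A B C D : Set ℕ} (h : IsSeg C D) (hs : Seg C D ⊆ Seg A B) :
    A ⊆ C ∧ D ⊆ B := by
  have hD : D.Infinite := h.2.mono sdiff_subset
  refine ⟨fun x hx => ?_, (hs ⟨hD, h.1, subset_rfl⟩).2.2⟩
  by_contra hxC
  have hmem : D \ {x} ∈ Seg C D :=
    ⟨hD.sdiff (finite_singleton x), fun y hy => ⟨h.1 hy, fun hyx => hxC (hyx ▸ hy)⟩, sdiff_subset⟩
  exact ((hs hmem).2.1 hx).2 rfl

lemma IsVZero.mono {S T : Set (Set ℕ)} (hT : IsVZero T) (hST : S ⊆ T) : IsVZero S := by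
  intro A B hAB
  obtain ⟨C, D, hCD, hsub, hdisj⟩ := hT A B hAB
  exact ⟨C, D, hCD, hsub, subset_empty_iff.1 (hdisj ▸ inter_subset_inter_right _ hST)⟩

/-- Below any segment there is one that stays disjoint from a given v⁰-set after finitely many
prescribed points outside it are added to its upper end. -/
lemma IsVZero.exists_seg_union {S : Set (Set ℕ)} (hS : IsVZero S) (F : Finset ℕ) :
    ∀ A B, IsSeg A B → Disjoint (F : Set ℕ) B →
      ∃ C D, IsSeg C D ∧ A ⊆ C ∧ D ⊆ B ∧ Seg C (D ∪ F) ∩ S = ∅ := by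
  induction F using Finset.induction_on with
  | empty =>
    intro A B hAB _
    obtain ⟨C, D, hCD, hsub, hdisj⟩ := hS A B hAB
    obtain ⟨hAC, hDB⟩ := hCD.subset_of_Seg_subset hsub
    exact ⟨C, D, hCD, hAC, hDB, by simpa using hdisj⟩
  | insert a F ha ih =>
    intro A B hAB hF
    rw [Finset.coe_insert, disjoint_insert_left] at hF
    obtain ⟨haB, hFB⟩ := hF
    obtain ⟨C, D, hCD, hAC, hDB, hdisj⟩ := ih A B hAB hFB
    have haD : a ∉ D := fun h => haB (hDB h)
    have hseg : IsSeg (insert a C) (insert a D) := by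
      refine ⟨insert_subset_insert hCD.1, hCD.2.mono fun x hx => ⟨Or.inr hx.1, ?_⟩⟩
      rintro (rfl | hxC)
      exacts [haD hx.1, hx.2 hxC]
    have hFD : Disjoint (F : Set ℕ) (insert a D) :=
      disjoint_insert_right.2 ⟨by simpa using ha, hFB.mono_right hDB⟩
    obtain ⟨C', D', hCD', hCC', hDD', hdisj'⟩ := ih _ _ hseg hFD
    have haC' : a ∈ C' := hCC' (mem_insert _ _)
    refine ⟨C' \ {a}, D' \ {a}, ⟨sdiff_subset_sdiff_left hCD'.1, ?_⟩, ?_, ?_, ?_⟩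
    · refine hCD'.2.mono fun x hx => ⟨⟨hx.1, ?_⟩, fun h => hx.2 h.1⟩
      rintro rfl
      exact hx.2 haC'
    · refine fun x hx => ⟨hCC' (Or.inr (hAC hx)), ?_⟩
      rintro rfl
      exact haB (hAB.1 hx)
    · exact fun x hx => hDB ((hDD' hx.1).resolve_left hx.2)
    · rw [← disjoint_iff_inter_eq_empty, disjoint_left] at hdisj hdisj' ⊢
      rintro X ⟨hX, hCX, hXD⟩
      by_cases haX : a ∈ X
      · refine hdisj' ⟨hX, fun x hx => ?_, fun x hx => ?_⟩
        · by_cases hxa : x = a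
          · exact hxa ▸ haX
          · exact hCX ⟨hx, hxa⟩
        · rcases hXD hx with h | h
          · exact Or.inl h.1
          · rcases Finset.mem_insert.1 h with rfl | h
            exacts [Or.inl (hCD'.1 haC'), Or.inr h]
      · refine hdisj ⟨hX, fun x hx => hCX ⟨hCC' (Or.inr hx), ?_⟩, fun x hx => ?_⟩
        · rintro rfl
          exact haD (hCD.1 hx)
        · rcases hXD hx with h | h
          · exact Or.inl ((hDD' h.1).resolve_left h.2)
          · rcases Finset.mem_insert.1 h with rfl | h
            exacts [absurd hx haX, Or.inr h]

/-- A segment can be shrunk off a v⁰-set while keeping finitely many of its free points free. -/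
lemma IsVZero.exists_seg_of_finset {S : Set (Set ℕ)} (hS : IsVZero S) {A B : Set ℕ}
    (hAB : IsSeg A B) (F : Finset ℕ) (hF : (F : Set ℕ) ⊆ B \ A) :
    ∃ C D, IsSeg C D ∧ A ⊆ C ∧ D ⊆ B ∧ (F : Set ℕ) ⊆ D \ C ∧ Seg C D ∩ S = ∅ := by
  have hseg : IsSeg A (B \ F) := by
    refine ⟨fun x hx => ⟨hAB.1 hx, fun h => (hF h).2 hx⟩, ?_⟩
    rw [sdiff_sdiff_comm]
    exact hAB.2.sdiff F.finite_toSet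
  obtain ⟨C, D, hCD, hAC, hDB, hdisj⟩ := hS.exists_seg_union F A _ hseg disjoint_sdiff_right
  refine ⟨C, D ∪ F, ⟨hCD.1.trans subset_union_left, ?_⟩, hAC, ?_, ?_, hdisj⟩
  · exact hCD.2.mono (sdiff_subset_sdiff_left subset_union_left)
  · exact union_subset (hDB.trans sdiff_subset) (hF.trans sdiff_subset)
  · exact fun x hx => ⟨Or.inr hx, fun h => (hDB (hCD.1 h)).2 hx⟩

/-- A segment together with finitely many of its free points. -/
structure MarkedSeg where
  lower : Set ℕ
  upper : Set ℕ
  marks : Finset ℕ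
  isSeg : IsSeg lower upper
  marks_subset : (marks : Set ℕ) ⊆ upper \ lower

lemma IsVZero.exists_markedSeg {S : Set (Set ℕ)} (hS : IsVZero S) (p : MarkedSeg) :
    ∃ q : MarkedSeg, p.lower ⊆ q.lower ∧ q.upper ⊆ p.upper ∧ p.marks ⊂ q.marks ∧
      Seg q.lower q.upper ∩ S = ∅ := by
  obtain ⟨C, D, hCD, hAC, hDB, hF, hdisj⟩ :=
    hS.exists_seg_of_finset p.isSeg p.marks p.marks_subset
  obtain ⟨a, ha, haF⟩ := hCD.2.exists_notMem_finset p.marks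
  refine ⟨⟨C, D, insert a p.marks, hCD, ?_⟩, hAC, hDB, Finset.ssubset_insert haF, hdisj⟩
  rw [Finset.coe_insert]
  exact insert_subset ha hF

lemma IsVZero.iUnion {S : ℕ → Set (Set ℕ)} (hS : ∀ n, IsVZero (S n)) : IsVZero (⋃ n, S n) := by
  intro A B hAB
  choose next hlower hupper hmarks hdisj using fun n => (hS n).exists_markedSeg
  let p : ℕ → MarkedSeg := fun n => Nat.rec ⟨A, B, ∅, hAB, by simp⟩ next n
  have hA : Monotone fun n => (p n).lower := monotone_nat_of_le_succ fun n => hlower n (p n)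
  have hB : Antitone fun n => (p n).upper := antitone_nat_of_succ_le fun n => hupper n (p n)
  have hF : StrictMono fun n => (p n).marks := strictMono_nat_of_lt_succ fun n => hmarks n (p n)
  have hfree : ∀ n, ((p n).marks : Set ℕ) ⊆ (⋂ k, (p k).upper) \ ⋃ k, (p k).lower := by
    intro n x hx
    have hmem (k : ℕ) : x ∈ (p (max n k)).upper \ (p (max n k)).lower :=
      (p _).marks_subset (hF.monotone (le_max_left n k) hx)
    refine ⟨mem_iInter.2 fun k => hB (le_max_right n k) (hmem k).1, fun h => ?_⟩
    obtain ⟨k, hk⟩ := mem_iUnion.1 h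
    exact (hmem k).2 (hA (le_max_right n k) hk)
  refine ⟨⋃ n, (p n).lower, ⋂ n, (p n).upper, ⟨?_, fun hfin => ?_⟩, ?_, ?_⟩
  · refine iUnion_subset fun m => subset_iInter fun n => ?_
    exact (hA (le_max_left m n)).trans ((p _).isSeg.1.trans (hB (le_max_right m n)))
  · refine not_injective_infinite_finite
      (fun n => (⟨(p n).marks, ?_⟩ : hfin.toFinset.powerset)) fun m n h => ?_
    · rw [Finset.mem_powerset]
      exact fun x hx => hfin.mem_toFinset.2 (hfree n hx)
    · exact hF.injective (congrArg Subtype.val h)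
  · exact Seg_mono (subset_iUnion (fun n => (p n).lower) 0) (iInter_subset (fun n => (p n).upper) 0)
  · rw [inter_iUnion, iUnion_eq_empty]
    intro n
    refine subset_empty_iff.1 (hdisj n (p n) ▸ inter_subset_inter_left _ ?_)
    exact Seg_mono (subset_iUnion (fun n => (p n).lower) (n + 1))
      (iInter_subset (fun n => (p n).upper) (n + 1))

lemma not_isVZero_setOf_infinite : ¬ IsVZero {X : Set ℕ | X.Infinite} := by
  intro h
  obtain ⟨C, D, hCD, -, hdisj⟩ := h ∅ univ ⟨empty_subset _, by simpa using infinite_univ⟩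
  have hD : D.Infinite := hCD.2.mono sdiff_subset
  exact (hdisj ▸ ⟨⟨hD, hCD.1, subset_rfl⟩, hD⟩ : D ∈ (∅ : Set (Set ℕ)))

/-- `(v⁰)` is a σ-ideal on `[ω]^ω`. -/
theorem vZero_sigma_ideal :
    (∀ S T : Set (Set ℕ), IsVZero T → S ⊆ T → IsVZero S) ∧
    (∀ S : ℕ → Set (Set ℕ), (∀ n, IsVZero (S n)) → IsVZero (⋃ n, S n)) ∧
    ¬ IsVZero {X : Set ℕ | X.Infinite} := by
  exact ⟨fun _ _ hT hST => hT.mono hST, fun _ hS => IsVZero.iUnion hS, not_isVZero_setOf_infinite⟩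
end

section
/- Every set S ⊆ [ω]^ω of cardinality strictly less than the continuum 𝔠 is a v⁰-set. -/
open Set

/-- Every subset of `[ω]^ω` of cardinality less than the continuum is a v⁰-set. -/
theorem small_set_isVZero (S : Set (Set ℕ)) (hsub : S ⊆ {X : Set ℕ | X.Infinite})
    (hcard : Cardinal.mk ↥S < Cardinal.continuum) : IsVZero S := by
  rintro A B ⟨hAB, hinf⟩
  let f : ℕ ↪ ↥(B \ A) := hinf.natEmbedding
  have f_eq {m n : ℕ} (h : (f m : ℕ) = f n) : m = n := f.injective (Subtype.ext h)
  let C (T : Set ℕ) : Set ℕ := A ∪ (fun n => (f (2 * n) : ℕ)) '' T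
  let D (T : Set ℕ) : Set ℕ := C T ∪ range fun n => (f (2 * n + 1) : ℕ)
  have hCA (T) : A ⊆ C T := subset_union_left
  have hDB (T) : D T ⊆ B := by
    rintro x ((hx | ⟨n, -, rfl⟩) | ⟨n, rfl⟩)
    exacts [hAB hx, (f _).2.1, (f _).2.1]
  have hCD (T) : IsSeg (C T) (D T) := by
    refine ⟨subset_union_left, (infinite_range_of_injective
      (f := fun n => (f (2 * n + 1) : ℕ)) fun m n h => ?_).mono ?_⟩
    · have := f_eq h
      omega
    · rintro _ ⟨n, rfl⟩
      refine ⟨Or.inr ⟨n, rfl⟩, ?_⟩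
      rintro (h | ⟨m, -, h⟩)
      · exact (f _).2.2 h
      · have := f_eq h
        omega
  by_contra! hS
  have hmeet (T) : ∃ X, X ∈ Seg (C T) (D T) ∩ S :=
    hS _ _ (hCD T) fun X hX =>
      ⟨hX.1, (hCA T).trans hX.2.1, hX.2.2.trans (hDB T)⟩
  choose g hg using hmeet
  have mem_g (T) (n : ℕ) : (f (2 * n) : ℕ) ∈ g T ↔ n ∈ T := by
    refine ⟨fun h => ?_, fun h => (hg T).1.2.1 (Or.inr ⟨n, h, rfl⟩)⟩
    rcases (hg T).1.2.2 h with (h | ⟨m, hm, h⟩) | ⟨m, h⟩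
    · exact ((f _).2.2 h).elim
    · have := f_eq h
      obtain rfl : m = n := by omega
      exact hm
    · have := f_eq h
      omega
  have hginj : Function.Injective fun T => (⟨g T, (hg T).2⟩ : S) := by
    intro T U h
    have hTU : g T = g U := congrArg Subtype.val h
    ext n
    rw [← mem_g T, ← mem_g U, hTU]
  have hle := Cardinal.mk_le_of_injective hginj
  rw [Cardinal.mk_set, Cardinal.mk_nat, Cardinal.two_power_aleph0] at hle
  exact hle.not_gt hcard
end

section
/- If H is a v-matrix of cardinality strictly less than κ(v), then there exists a v-partition P which refines every v-partition Q ∈ H. -/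
open Set

/-- A set of infinite subsets of `ℕ` is a *-segment if it is of the form `⟨A,B⟩*`. -/
def IsStarSeg (P : Set (Set ℕ)) : Prop := ∃ A B, IsSeg A B ∧ P = StarSeg A B

/-- Two *-segments are *-disjoint when their intersection is countable. -/
def StarDisjoint (P Q : Set (Set ℕ)) : Prop := (P ∩ Q).Countable

/-- A v-partition: a maximal family of pairwise *-disjoint *-segments. -/
def IsVPartition (P : Set (Set (Set ℕ))) : Prop :=
  (∀ X ∈ P, IsStarSeg X) ∧
  (∀ X ∈ P, ∀ Y ∈ P, X ≠ Y → StarDisjoint X Y) ∧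
  (∀ R, IsStarSeg R → R ∉ P → ∃ X ∈ P, ¬ StarDisjoint R X)

/-- `P` refines `Q`: every member of `P` is contained in some member of `Q`. -/
def Refines (P Q : Set (Set (Set ℕ))) : Prop := ∀ X ∈ P, ∃ Y ∈ Q, X ⊆ Y

/-- A v-matrix is a collection of v-partitions. -/
def IsVMatrix (H : Set (Set (Set (Set ℕ)))) : Prop := ∀ P ∈ H, IsVPartition P

/-- A v-matrix `H` is shattering: for every *-segment `⟨A,B⟩*` some partition in `H`
has two distinct members whose intersections with `⟨A,B⟩*` are two different *-segments. -/
def Shattering (H : Set (Set (Set (Set ℕ)))) : Prop :=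
  IsVMatrix H ∧ ∀ A B, IsSeg A B → ∃ P ∈ H, ∃ X ∈ P, ∃ Y ∈ P, X ≠ Y ∧
    IsStarSeg (X ∩ StarSeg A B) ∧ IsStarSeg (Y ∩ StarSeg A B) ∧
    X ∩ StarSeg A B ≠ Y ∩ StarSeg A B

/-- `κ(v)`: the least cardinality of a shattering v-matrix. -/
noncomputable def kappaV : Cardinal :=
  sInf {c : Cardinal | ∃ H : Set (Set (Set (Set ℕ))), Shattering H ∧ Cardinal.mk ↥H = c}

theorem countable_setOf_almostEq (M : Set ℕ) :
    {X | AlmostSub M X ∧ AlmostSub X M}.Countable := by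
  refine ((countable_ofPred_finite_subset (countable_univ (α := ℕ))).image
    (fun F => symmDiff M F)).mono ?_
  rintro X ⟨h1, h2⟩
  refine ⟨symmDiff M X, ⟨?_, subset_univ _⟩, symmDiff_symmDiff_cancel_left M X⟩
  rw [Set.symmDiff_def]
  exact h1.union h2

theorem IsSeg.exists_injective_range {A B : Set ℕ} (h : IsSeg A B) :
    ∃ e : ℕ → ℕ, Function.Injective e ∧ range e = B \ A := by
  have h_inf := h.2
  refine ⟨Nat.nth (· ∈ B \ A), Nat.nth_injective h_inf, Nat.range_nth_of_infinite h_inf⟩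

theorem StarSeg.mono {A B C D : Set ℕ} (hA : AlmostSub C A) (hB : AlmostSub B D) :
    StarSeg A B ⊆ StarSeg C D := by
  rintro X ⟨hX, h1, h2⟩
  refine ⟨hX, (hA.union h1).subset ?_, (hB.union h2).subset ?_⟩ <;>
  · intro x
    simp only [mem_sdiff, mem_union]
    tauto

theorem IsSeg.not_countable_starSeg {A B : Set ℕ} (h : IsSeg A B) :
    ¬ (StarSeg A B).Countable := by
  intro hc
  obtain ⟨e, he, hr⟩ := h.exists_injective_range
  have h_inj : Function.Injective fun X : Set ℕ => A ∪ e '' X := by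
    intro X Y hXY
    have hA : ∀ Z : Set ℕ, e '' Z ∩ A = ∅ := fun Z => by
      ext x
      simp only [mem_inter_iff, mem_image, mem_empty_iff_false, iff_false]
      rintro ⟨⟨y, -, rfl⟩, hy⟩
      exact (hr ▸ mem_range_self y : e y ∈ B \ A).2 hy
    have h_diff : ∀ Z : Set ℕ, (A ∪ e '' Z) \ A = e '' Z := fun Z => by
      rw [union_sdiff_left, sdiff_eq_left, disjoint_iff_inter_eq_empty, hA]
    refine he.image_injective ?_
    rw [← h_diff X, ← h_diff Y]
    exact congrArg (· \ A) hXY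
  have h_univ : (univ : Set (Set ℕ)).Countable := by
    refine ((hc.preimage_of_injOn h_inj.injOn).union
      (countable_ofPred_finite_subset (countable_univ (α := ℕ)))).mono ?_
    intro X _
    by_cases hX : X.Finite
    · exact Or.inr ⟨hX, subset_univ _⟩
    · refine Or.inl ⟨(Infinite.image he.injOn hX).mono subset_union_right, ?_, ?_⟩
      · exact finite_empty.subset fun x hx => hx.2 (Or.inl hx.1)
      · refine finite_empty.subset ?_
        rintro x ⟨hx | ⟨y, -, rfl⟩, hx'⟩
        · exact hx' (h.1 hx)
        · exact hx' (hr ▸ mem_range_self y : e y ∈ B \ A).1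
  have := countable_univ_iff.mp h_univ
  obtain ⟨f, hf⟩ := exists_injective_nat (Set ℕ)
  exact Function.cantor_injective f hf

theorem IsStarSeg.not_countable {R : Set (Set ℕ)} (h : IsStarSeg R) : ¬ R.Countable := by
  obtain ⟨A, B, hAB, rfl⟩ := h
  exact hAB.not_countable_starSeg

theorem almostSub_and_infinite_of_not_starDisjoint {A B C D : Set ℕ}
    (h : ¬ StarDisjoint (StarSeg A B) (StarSeg C D)) :
    AlmostSub (A ∪ C) (B ∩ D) ∧ ((B ∩ D) \ (A ∪ C)).Infinite := by
  have h_ne : (StarSeg A B ∩ StarSeg C D).Nonempty := by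
    by_contra hne
    rw [not_nonempty_iff_eq_empty] at hne
    exact h (by rw [StarDisjoint, hne]; exact countable_empty)
  obtain ⟨X, ⟨-, h1, h2⟩, -, h3, h4⟩ := h_ne
  refine ⟨?_, fun h_fin => h ?_⟩
  · refine (((h1.union h2).union h3).union h4).subset fun x => ?_
    simp only [mem_sdiff, mem_union, mem_inter_iff]
    tauto
  · refine (countable_setOf_almostEq (A ∪ C)).mono ?_
    rintro Y ⟨⟨-, k1, k2⟩, -, k3, k4⟩
    refine ⟨(k1.union k3).subset fun x => ?_, ((k2.union k4).union h_fin).subset fun x => ?_⟩ <;>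
    · simp only [mem_sdiff, mem_union, mem_inter_iff]
      tauto

theorem IsStarSeg.inter {R S : Set (Set ℕ)} (hR : IsStarSeg R) (hS : IsStarSeg S)
    (h : ¬ StarDisjoint R S) : IsStarSeg (R ∩ S) := by
  obtain ⟨A, B, -, rfl⟩ := hR
  obtain ⟨C, D, -, rfl⟩ := hS
  obtain ⟨h1, h2⟩ := almostSub_and_infinite_of_not_starDisjoint h
  refine ⟨(A ∪ C) ∩ (B ∩ D), B ∩ D, ⟨inter_subset_right, by rwa [sdiff_inter_self_eq_sdiff]⟩, ?_⟩
  ext X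
  constructor
  · rintro ⟨⟨k0, k1, k2⟩, -, k3, k4⟩
    refine ⟨k0, (k1.union k3).subset fun x => ?_, (k2.union k4).subset fun x => ?_⟩ <;>
    · simp only [mem_sdiff, mem_union, mem_inter_iff]
      tauto
  · rintro ⟨k0, k1, k2⟩
    refine ⟨⟨k0, (h1.union k1).subset fun x => ?_, k2.subset fun x => ?_⟩,
      k0, (h1.union k1).subset fun x => ?_, k2.subset fun x => ?_⟩ <;>
    · simp only [mem_sdiff, mem_union, mem_inter_iff]
      tauto

theorem IsSeg.almostSub_of_starSeg_subset {A B C D : Set ℕ} (h : IsSeg A B)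
    (hs : StarSeg A B ⊆ StarSeg C D) : AlmostSub C A ∧ AlmostSub B D := by
  obtain ⟨t, u, htu, hd, hc⟩ := h.2.exists_union_disjoint_cardinal_eq_of_infinite
  have h_inf : t.Infinite ∧ u.Infinite := by
    have h_iff : t.Finite ↔ u.Finite := by
      rw [← Cardinal.lt_aleph0_iff_set_finite, ← Cardinal.lt_aleph0_iff_set_finite, hc]
    have h_not : ¬ (t.Finite ∧ u.Finite) := fun hf => h.2 (htu ▸ hf.1.union hf.2)
    simp only [Set.Infinite]
    tauto
  have h_mem : ∀ v ⊆ B \ A, v.Infinite → A ∪ v ∈ StarSeg C D := fun v hv h_v =>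
    hs ⟨h_v.mono subset_union_right, finite_empty.subset fun x hx => hx.2 (Or.inl hx.1),
      finite_empty.subset fun x hx =>
        hx.2 (hx.1.elim (fun hA => h.1 hA) fun hxv => (hv hxv).1)⟩
  obtain ⟨-, h1, h2⟩ := h_mem t (htu ▸ subset_union_left) h_inf.1
  obtain ⟨-, h3, h4⟩ := h_mem u (htu ▸ subset_union_right) h_inf.2
  refine ⟨(h1.union h3).subset fun x hx => ?_, (h2.union h4).subset fun x hx => ?_⟩
  · have : x ∈ t → x ∉ u := fun k => disjoint_left.mp hd k
    simp only [mem_sdiff, mem_union] at hx ⊢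
    tauto
  · have : x ∈ B \ A ↔ x ∈ t ∨ x ∈ u := by rw [← htu]; rfl
    simp only [mem_sdiff, mem_union] at hx this ⊢
    tauto

theorem IsVPartition.exists_not_starDisjoint {P : Set (Set (Set ℕ))} (hP : IsVPartition P)
    {R : Set (Set ℕ)} (hR : IsStarSeg R) : ∃ X ∈ P, ¬ StarDisjoint R X := by
  by_cases h : R ∈ P
  · exact ⟨R, h, by rw [StarDisjoint, inter_self]; exact hR.not_countable⟩
  · exact hP.2.2 R hR h

/-- A dense class of *-segments contains a v-partition. -/
theorem exists_isVPartition_subset (𝒟 : Set (Set (Set ℕ))) (h𝒟 : ∀ R ∈ 𝒟, IsStarSeg R)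
    (h_dense : ∀ R, IsStarSeg R → ∃ S ∈ 𝒟, S ⊆ R) : ∃ P ⊆ 𝒟, IsVPartition P := by
  obtain ⟨P, hP⟩ := zorn_subset {P | P ⊆ 𝒟 ∧ P.Pairwise StarDisjoint} fun c hc h_chain =>
    ⟨⋃₀ c, ⟨sUnion_subset fun s hs => (hc hs).1,
      (pairwise_sUnion h_chain.directedOn).2 fun s hs => (hc hs).2⟩,
      fun s hs => subset_sUnion_of_mem hs⟩
  refine ⟨P, hP.prop.1, fun X hX => h𝒟 X (hP.prop.1 hX), fun X hX Y hY => hP.prop.2 hX hY,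
    fun R hR _ => ?_⟩
  obtain ⟨S, hS, hSR⟩ := h_dense R hR
  by_contra! h_disj
  have h_disj' : ∀ X ∈ P, StarDisjoint S X := fun X hX =>
    (h_disj X hX).mono (inter_subset_inter_left X hSR)
  have h_mem : S ∈ P := by
    refine hP.le_of_ge ⟨insert_subset hS hP.prop.1, ?_⟩ (subset_insert S P) (mem_insert S P)
    refine hP.prop.2.insert fun X hX _ => ⟨h_disj' X hX, ?_⟩
    rw [StarDisjoint, inter_comm]
    exact h_disj' X hX
  refine (h𝒟 S hS).not_countable ?_
  simpa [StarDisjoint] using h_disj' S h_mem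

/-- If no two distinct members of a v-partition split a *-segment, then that *-segment lies
inside a single member. -/
theorem IsVPartition.exists_superset_of_not_split {P : Set (Set (Set ℕ))} (hP : IsVPartition P)
    {A B : Set ℕ} (hAB : IsSeg A B)
    (h : ¬ ∃ X ∈ P, ∃ Y ∈ P, X ≠ Y ∧ IsStarSeg (X ∩ StarSeg A B) ∧
      IsStarSeg (Y ∩ StarSeg A B) ∧ X ∩ StarSeg A B ≠ Y ∩ StarSeg A B) :
    ∃ X ∈ P, StarSeg A B ⊆ X := by
  have hT : IsStarSeg (StarSeg A B) := ⟨A, B, hAB, rfl⟩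
  obtain ⟨X, hX, hTX⟩ := hP.exists_not_starDisjoint hT
  have h_meet : ∀ A' B', IsSeg A' B' → StarSeg A' B' ⊆ StarSeg A B →
      ¬ StarDisjoint (StarSeg A' B') X := by
    intro A' B' h' h_sub h_disj
    obtain ⟨Y, hY, hRY⟩ := hP.exists_not_starDisjoint ⟨A', B', h', rfl⟩
    have hTY : ¬ StarDisjoint (StarSeg A B) Y := fun hc =>
      hRY (hc.mono (inter_subset_inter_left Y h_sub))
    have h_ne : X ≠ Y := fun heq => hRY (heq ▸ h_disj)
    refine h ⟨X, hX, Y, hY, h_ne, ?_, ?_, fun heq => ?_⟩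
    · rw [inter_comm]
      exact hT.inter (hP.1 X hX) hTX
    · rw [inter_comm]
      exact hT.inter (hP.1 Y hY) hTY
    · have h_sub : StarSeg A B ∩ X ⊆ X ∩ Y := fun Z hZ => by
        have h_mem : Z ∈ X ∩ StarSeg A B := ⟨hZ.2, hZ.1⟩
        rw [heq] at h_mem
        exact ⟨hZ.2, h_mem.1⟩
      exact hTX ((hP.2.1 X hX Y hY h_ne).mono h_sub)
  refine ⟨X, hX, ?_⟩
  obtain ⟨C, D, -, rfl⟩ := hP.1 X hX
  obtain ⟨h1, -⟩ := almostSub_and_infinite_of_not_starDisjoint hTX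
  refine StarSeg.mono ?_ ?_
  · by_contra h_inf
    refine (almostSub_and_infinite_of_not_starDisjoint
      (h_meet A (A ∪ (C ∩ B)) ⟨subset_union_left, fun h_fin => h_inf ?_⟩ ?_)).2 ?_
    · refine (h1.union h_fin).subset fun x => ?_
      simp only [mem_sdiff, mem_union, mem_inter_iff]
      tauto
    · refine StarSeg.mono (by simp [AlmostSub]) (finite_empty.subset fun x hx => ?_)
      have := @hAB.1 x
      simp only [mem_sdiff, mem_union, mem_inter_iff] at hx
      tauto
    · refine finite_empty.subset fun x => ?_
      simp only [mem_sdiff, mem_union, mem_inter_iff, mem_empty_iff_false]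
      tauto
  · by_contra h_inf
    refine (almostSub_and_infinite_of_not_starDisjoint
      (h_meet (A ∪ (B ∩ D)) B ⟨union_subset hAB.1 inter_subset_left,
        fun h_fin => h_inf ?_⟩ ?_)).2 ?_
    · refine (h1.union h_fin).subset fun x => ?_
      simp only [mem_sdiff, mem_union, mem_inter_iff]
      tauto
    · refine StarSeg.mono (finite_empty.subset fun x hx => hx.2 (Or.inl hx.1))
        (by simp [AlmostSub])
    · refine finite_empty.subset fun x => ?_
      simp only [mem_sdiff, mem_union, mem_inter_iff, mem_empty_iff_false]
      tauto

theorem exists_common_starSeg_of_not_shattering {H : Set (Set (Set (Set ℕ)))}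
    (hH : IsVMatrix H) (h : ¬ Shattering H) :
    ∃ A B, IsSeg A B ∧ ∀ P ∈ H, ∃ X ∈ P, StarSeg A B ⊆ X := by
  by_contra! h_split
  refine h ⟨hH, fun A B hAB => ?_⟩
  by_contra h_none
  obtain ⟨P, hP, h_P⟩ := h_split A B hAB
  obtain ⟨X, hX, hXs⟩ := (hH P hP).exists_superset_of_not_split hAB
    fun hs => h_none ⟨P, hP, hs⟩
  exact h_P X hX hXs

section Push

variable {A : Set ℕ} {e : ℕ → ℕ}

theorem almostSub_union_image {C D : Set ℕ} (h : AlmostSub C D) :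
    AlmostSub (A ∪ e '' C) (A ∪ e '' D) := by
  refine (h.image e).subset ?_
  rintro x ⟨hx | ⟨y, hy, rfl⟩, hx'⟩
  · exact absurd (Or.inl hx) hx'
  · exact ⟨y, ⟨hy, fun hyD => hx' (Or.inr ⟨y, hyD, rfl⟩)⟩, rfl⟩

theorem IsSeg.union_image (he : Function.Injective e) (hA : ∀ n, e n ∉ A) {C D : Set ℕ}
    (h : IsSeg C D) : IsSeg (A ∪ e '' C) (A ∪ e '' D) := by
  refine ⟨union_subset_union_right A (image_mono h.1), (h.2.image he.injOn).mono ?_⟩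
  rintro _ ⟨y, hy, rfl⟩
  refine ⟨Or.inr ⟨y, hy.1, rfl⟩, ?_⟩
  rintro (hyA | hyC)
  · exact hA y hyA
  · exact hy.2 ((he.mem_set_image).1 hyC)

/-- Below every *-segment there is one whose translate along `C ↦ A ∪ e '' C` lies inside a single
member of a given v-partition. -/
theorem IsVPartition.exists_starSeg_union_image_subset {Q : Set (Set (Set ℕ))}
    (hQ : IsVPartition Q) (he : Function.Injective e) (hA : ∀ n, e n ∉ A) {C D : Set ℕ}
    (h : IsSeg C D) : ∃ C' D', IsSeg C' D' ∧ StarSeg C' D' ⊆ StarSeg C D ∧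
      ∃ X ∈ Q, StarSeg (A ∪ e '' C') (A ∪ e '' D') ⊆ X := by
  obtain ⟨X, hX, hRX⟩ := hQ.exists_not_starDisjoint ⟨_, _, h.union_image he hA, rfl⟩
  obtain ⟨E, F, -, rfl⟩ := hQ.1 X hX
  obtain ⟨h1, h2⟩ := almostSub_and_infinite_of_not_starDisjoint hRX
  have h_image : ∀ (x : ℕ) (S : Set ℕ), e x ∈ A ∪ e '' S ↔ x ∈ S := fun x S => by
    rw [mem_union, he.mem_set_image, or_iff_right (hA x)]
  refine ⟨(C ∪ e ⁻¹' E) ∩ (D ∩ e ⁻¹' F), D ∩ e ⁻¹' F, ⟨inter_subset_right, fun h_fin => h2 ?_⟩,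
    StarSeg.mono ?_ ?_, _, hX, StarSeg.mono ?_ ?_⟩
  · refine (h_fin.image e).subset ?_
    rintro x ⟨⟨hx | ⟨y, hy, rfl⟩, hxF⟩, hx'⟩
    · exact absurd (Or.inl (Or.inl hx)) hx'
    · rw [mem_union, h_image] at hx'
      refine ⟨y, ⟨⟨hy, hxF⟩, fun hy' => hx' hy'.1⟩, rfl⟩
  · refine (Finite.preimage he.injOn h1).subset fun x hx => ?_
    have := @h.1 x
    simp only [mem_preimage, mem_sdiff, mem_union (e x) (A ∪ _), mem_inter_iff, h_image, mem_union x]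
      at hx ⊢
    tauto
  · exact finite_empty.subset fun x hx => hx.2 hx.1.1
  · refine h1.subset fun x hx => ⟨Or.inr hx.1, ?_⟩
    rintro ⟨hxA | ⟨y, hy, rfl⟩, hxF⟩
    · exact hx.2 (Or.inl hxA)
    · exact hx.2 ((h_image _ _).2 ⟨Or.inr hx.1, hy, hxF⟩)
  · refine h1.subset ?_
    rintro x ⟨hx | ⟨y, hy, rfl⟩, hxF⟩
    · exact ⟨Or.inl (Or.inl hx), fun hx' => hxF hx'.2⟩
    · exact absurd hy.2 hxF

end Push

/-- Below every *-segment there is one contained in a single member of each partition of a small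
v-matrix. -/
theorem exists_common_starSeg_below {H : Set (Set (Set (Set ℕ)))} (hH : IsVMatrix H)
    (hcard : Cardinal.mk ↥H < kappaV) {A B : Set ℕ} (hAB : IsSeg A B) :
    ∃ C D, IsSeg C D ∧ StarSeg C D ⊆ StarSeg A B ∧ ∀ Q ∈ H, ∃ X ∈ Q, StarSeg C D ⊆ X := by
  obtain ⟨e, he, hr⟩ := hAB.exists_injective_range
  have h_mem : ∀ n, e n ∈ B \ A := fun n => hr ▸ mem_range_self n
  have hA : ∀ n, e n ∉ A := fun n => (h_mem n).2
  have h_pull : ∀ Q : H, ∃ P ⊆ {R | ∃ C D, IsSeg C D ∧ R = StarSeg C D ∧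
      ∃ X ∈ Q.1, StarSeg (A ∪ e '' C) (A ∪ e '' D) ⊆ X}, IsVPartition P := fun Q => by
    refine exists_isVPartition_subset _ ?_ ?_
    · rintro R ⟨C, D, hCD, rfl, -⟩
      exact ⟨C, D, hCD, rfl⟩
    · rintro R ⟨C, D, hCD, rfl⟩
      obtain ⟨C', D', h', h_sub, hX⟩ :=
        (hH Q Q.2).exists_starSeg_union_image_subset he hA hCD
      exact ⟨_, ⟨C', D', h', rfl, hX⟩, h_sub⟩
  choose f hf hfP using h_pull
  have h_matrix : IsVMatrix (range f) := by
    rintro _ ⟨Q, rfl⟩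
    exact hfP Q
  have h_not : ¬ Shattering (range f) := fun hs =>
    (Cardinal.mk_range_le.trans_lt hcard).not_ge (csInf_le' ⟨_, hs, rfl⟩)
  obtain ⟨C, D, hCD, h_sub⟩ := exists_common_starSeg_of_not_shattering h_matrix h_not
  refine ⟨_, _, hCD.union_image he hA, StarSeg.mono ?_ ?_, fun Q hQ => ?_⟩
  · exact finite_empty.subset fun x hx => hx.2 (Or.inl hx.1)
  · refine finite_empty.subset ?_
    rintro x ⟨hx | ⟨y, -, rfl⟩, hx'⟩
    · exact hx' (hAB.1 hx)
    · exact hx' (h_mem y).1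
  · obtain ⟨R, hR, h_R⟩ := h_sub _ ⟨⟨Q, hQ⟩, rfl⟩
    obtain ⟨C', D', -, rfl, X, hX, hXs⟩ := hf _ hR
    obtain ⟨h1, h2⟩ := hCD.almostSub_of_starSeg_subset h_R
    exact ⟨X, hX, (StarSeg.mono (almostSub_union_image h1) (almostSub_union_image h2)).trans hXs⟩

/-- Lemma 9: a v-matrix of cardinality below `κ(v)` admits a common refinement. -/
theorem small_vMatrix_has_common_refinement (H : Set (Set (Set (Set ℕ))))
    (hH : IsVMatrix H) (hcard : Cardinal.mk ↥H < kappaV) :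
    ∃ P, IsVPartition P ∧ ∀ Q ∈ H, Refines P Q := by
  obtain ⟨P, hP, h_part⟩ := exists_isVPartition_subset
    {R | IsStarSeg R ∧ ∀ Q ∈ H, ∃ X ∈ Q, R ⊆ X} (fun R hR => hR.1) (by
      rintro R ⟨A, B, hAB, rfl⟩
      obtain ⟨C, D, hCD, h_sub, h⟩ := exists_common_starSeg_below hH hcard hAB
      exact ⟨_, ⟨⟨C, D, hCD, rfl⟩, h⟩, h_sub⟩)
  exact ⟨P, h_part, fun Q hQ X hX => (hP hX).2 Q hQ⟩
end

section
/- κ(v) is an uncountable regular cardinal, i.e. ω₁ ≤ κ(v) and κ(v) is regular. -/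
open Set

open Cardinal

theorem AlmostSub.of_subset {X Y : Set ℕ} (h : X ⊆ Y) : AlmostSub X Y := by
  simp [AlmostSub, Set.sdiff_eq_empty.2 h]

theorem AlmostSub.trans {X Y Z : Set ℕ} (h₁ : AlmostSub X Y) (h₂ : AlmostSub Y Z) :
    AlmostSub X Z := by
  refine (Set.Finite.union h₁ h₂).subset fun x hx => ?_
  by_cases hy : x ∈ Y
  · exact Or.inr ⟨hy, hx.2⟩
  · exact Or.inl ⟨hx.1, hy⟩

theorem AlmostSub.union {X Y Z : Set ℕ} (h₁ : AlmostSub X Z) (h₂ : AlmostSub Y Z) :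
    AlmostSub (X ∪ Y) Z := by
  simpa [AlmostSub, Set.union_sdiff_distrib] using Set.Finite.union h₁ h₂

theorem AlmostSub.inter {X Y Z : Set ℕ} (h₁ : AlmostSub X Y) (h₂ : AlmostSub X Z) :
    AlmostSub X (Y ∩ Z) := by
  refine (Set.Finite.union h₁ h₂).subset fun x hx => ?_
  by_cases hy : x ∈ Y
  · exact Or.inr ⟨hx.1, fun hz => hx.2 ⟨hy, hz⟩⟩
  · exact Or.inl ⟨hx.1, hy⟩

theorem IsSeg.infinite_right {A B : Set ℕ} (h : IsSeg A B) : B.Infinite :=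
  h.2.mono Set.sdiff_subset

theorem Set.Infinite.exists_split {S : Set ℕ} (hS : S.Infinite) :
    ∃ E F : Set ℕ, E ⊆ S ∧ F ⊆ S ∧ Disjoint E F ∧ E.Infinite ∧ F.Infinite := by
  obtain ⟨t, u, h, hd, hc⟩ := hS.exists_union_disjoint_cardinal_eq_of_infinite
  have key : t.Infinite ↔ u.Infinite := by
    rw [← Set.infinite_coe_iff, ← Set.infinite_coe_iff, Cardinal.infinite_iff,
      Cardinal.infinite_iff, hc]
  have htu : t.Infinite ∨ u.Infinite := by
    rw [← Set.infinite_union, h]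
    exact hS
  exact ⟨t, u, h ▸ Set.subset_union_left, h ▸ Set.subset_union_right, hd, by tauto, by tauto⟩

theorem starSeg_mono {A B C D : Set ℕ} (h₁ : AlmostSub C A) (h₂ : AlmostSub B D) :
    StarSeg A B ⊆ StarSeg C D :=
  fun _ hX => ⟨hX.1, h₁.trans hX.2.1, hX.2.2.trans h₂⟩

theorem starSeg_subset_iff {A B C D : Set ℕ} (h : IsSeg A B) :
    StarSeg A B ⊆ StarSeg C D ↔ AlmostSub C A ∧ AlmostSub B D := by
  refine ⟨fun hs => ⟨?_, ?_⟩, fun h => starSeg_mono h.1 h.2⟩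
  · obtain ⟨E, F, hE, hF, hd, hEi, hFi⟩ := h.2.exists_split
    have aux : ∀ G ⊆ B \ A, G.Infinite → AlmostSub C (A ∪ G) := fun G hG hGi =>
      (hs ⟨hGi.mono Set.subset_union_right, .of_subset Set.subset_union_left,
        .of_subset (Set.union_subset h.1 (hG.trans Set.sdiff_subset))⟩).2.1
    refine ((aux E hE hEi).inter (aux F hF hFi)).trans (.of_subset fun x hx => ?_)
    rcases hx with ⟨hx | hx, hx' | hx'⟩
    · exact hx
    · exact hx
    · exact hx'
    · exact (Set.disjoint_left.1 hd hx hx').elim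
  · exact (hs ⟨h.infinite_right, .of_subset h.1, .of_subset subset_rfl⟩).2.2

theorem countable_setOf_almost_eq (A : Set ℕ) :
    {X : Set ℕ | AlmostSub X A ∧ AlmostSub A X}.Countable := by
  have h := (Set.countable_ofPred_finite_subset (Set.countable_univ (α := ℕ))).preimage_of_injOn
    (f := fun X => symmDiff X A) (symmDiff_left_injective A).injOn
  refine Set.Countable.mono ?_ h
  intro X hX
  exact ⟨Set.Finite.union hX.1 hX.2, Set.subset_univ _⟩

theorem starSeg_countable {A B : Set ℕ} (h : AlmostSub B A) : (StarSeg A B).Countable := by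
  refine Set.Countable.mono ?_ (countable_setOf_almost_eq A)
  intro X hX
  exact ⟨hX.2.2.trans h, hX.2.1⟩

theorem IsStarSeg.not_countable_s9 {U : Set (Set ℕ)} (hU : IsStarSeg U) : ¬ U.Countable := by
  obtain ⟨A, B, h, rfl⟩ := hU
  intro hc
  let f := h.2.natEmbedding
  have hfin := Set.countable_ofPred_finite_subset (Set.countable_univ (α := ℕ))
  have hinj : Function.Injective fun S : Set ℕ => A ∪ (fun n => (f n : ℕ)) '' S := by
    intro S T hST
    have hf : Function.Injective fun n => (f n : ℕ) := Subtype.val_injective.comp f.injective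
    have aux : ∀ S T : Set ℕ, A ∪ (fun n => (f n : ℕ)) '' S = A ∪ (fun n => (f n : ℕ)) '' T →
        S ⊆ T := by
      intro S T hST n hn
      have : (f n : ℕ) ∈ A ∪ (fun n => (f n : ℕ)) '' T := hST ▸ Or.inr ⟨n, hn, rfl⟩
      rcases this with h | ⟨m, hm, hmn⟩
      · exact ((f n).2.2 h).elim
      · exact hf hmn ▸ hm
    exact (aux S T hST).antisymm (aux T S hST.symm)
  have hun : ¬ (Set.univ : Set (Set ℕ)).Countable := fun hcu => by
    have := Set.countable_univ_iff.1 hcu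
    obtain ⟨g, hg⟩ := exists_surjective_nat (Set ℕ)
    exact Function.cantor_surjective g hg
  refine hun (Set.Countable.mono (fun S _ => ?_)
    ((hc.union hfin).preimage_of_injOn hinj.injOn))
  by_cases hi : (A ∪ (fun n => (f n : ℕ)) '' S).Finite
  · exact Or.inr ⟨hi, Set.subset_univ _⟩
  · refine Or.inl ⟨hi, .of_subset Set.subset_union_left,
      .of_subset (Set.union_subset h.1 ?_)⟩
    rintro _ ⟨n, -, rfl⟩
    exact (f n).2.1

theorem exists_isSeg_of_inter_not_countable {A B C D : Set ℕ} (h : IsSeg A B)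
    (hc : ¬ (StarSeg A B ∩ StarSeg C D).Countable) :
    ∃ A' B', A ⊆ A' ∧ B' ⊆ B ∧ IsSeg A' B' ∧ StarSeg A' B' = StarSeg A B ∩ StarSeg C D := by
  obtain ⟨X, hX, hX'⟩ : (StarSeg A B ∩ StarSeg C D).Nonempty := by
    by_contra he
    rw [Set.not_nonempty_iff_eq_empty] at he
    simp [he] at hc
  have hCB : AlmostSub C B := hX'.2.1.trans hX.2.2
  have hAD : AlmostSub A D := hX.2.1.trans hX'.2.2
  have hCD : AlmostSub C D := hX'.2.1.trans hX'.2.2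
  have hA' : AlmostSub (A ∪ C ∩ B) D :=
    hAD.union ((AlmostSub.of_subset Set.inter_subset_left).trans hCD)
  have hC : AlmostSub C (A ∪ C ∩ B) :=
    ((AlmostSub.of_subset subset_rfl).inter hCB).trans (.of_subset Set.subset_union_right)
  have hB' : (A ∪ C ∩ B) ∪ B ∩ D ⊆ B := by
    have := h.1
    intro x
    simp only [Set.mem_union, Set.mem_inter_iff]
    have := @this x
    tauto
  have heq : StarSeg (A ∪ C ∩ B) ((A ∪ C ∩ B) ∪ B ∩ D) = StarSeg A B ∩ StarSeg C D := by
    refine Set.Subset.antisymm (Set.subset_inter ?_ ?_) ?_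
    · exact starSeg_mono (.of_subset Set.subset_union_left) (.of_subset hB')
    · exact starSeg_mono hC (hA'.union (.of_subset Set.inter_subset_right))
    · rintro Y ⟨h₁, h₂⟩
      exact ⟨h₁.1, h₁.2.1.union ((AlmostSub.of_subset Set.inter_subset_left).trans h₂.2.1),
        (h₁.2.2.inter h₂.2.2).trans (.of_subset Set.subset_union_right)⟩
  refine ⟨_, _, Set.subset_union_left, hB', ⟨Set.subset_union_left, fun hf => hc ?_⟩, heq⟩
  rw [← heq]
  exact starSeg_countable hf

theorem IsStarSeg.inter_s9 {U V : Set (Set ℕ)} (hU : IsStarSeg U) (hV : IsStarSeg V)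
    (h : ¬ (U ∩ V).Countable) : IsStarSeg (U ∩ V) := by
  obtain ⟨A, B, hAB, rfl⟩ := hU
  obtain ⟨C, D, hCD, rfl⟩ := hV
  obtain ⟨A', B', -, -, h', heq⟩ := exists_isSeg_of_inter_not_countable hAB h
  exact ⟨A', B', h', heq.symm⟩

theorem IsStarSeg.exists_disjoint {U : Set (Set ℕ)} (hU : IsStarSeg U) :
    ∃ V W, IsStarSeg V ∧ IsStarSeg W ∧ V ⊆ U ∧ W ⊆ U ∧ (V ∩ W).Countable := by
  obtain ⟨A, B, h, rfl⟩ := hU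
  obtain ⟨E, F, hE, hF, hd, hEi, hFi⟩ := h.2.exists_split
  have hAE : A ∪ E ⊆ B := Set.union_subset h.1 (hE.trans Set.sdiff_subset)
  refine ⟨_, _, ⟨A, A ∪ E, ⟨Set.subset_union_left, hEi.mono fun x hx => ⟨Or.inr hx, (hE hx).2⟩⟩,
    rfl⟩, ⟨A ∪ E, B, ⟨hAE, hFi.mono fun x hx => ⟨(hF hx).1, ?_⟩⟩, rfl⟩,
    starSeg_mono (.of_subset subset_rfl) (.of_subset hAE),
    starSeg_mono (.of_subset Set.subset_union_left) (.of_subset subset_rfl),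
    Set.Countable.mono ?_ (countable_setOf_almost_eq (A ∪ E))⟩
  · rintro (hx' | hx')
    · exact (hF hx).2 hx'
    · exact Set.disjoint_left.1 hd hx' hx
  · intro X hX
    exact ⟨hX.1.2.2, hX.2.2.1⟩

theorem exists_isSeg_of_monotone {A B : ℕ → Set ℕ} (hA : Monotone A) (hB : Antitone B)
    (h : ∀ n, IsSeg (A n) (B n)) :
    ∃ C D, IsSeg C D ∧ ∀ n, StarSeg C D ⊆ StarSeg (A n) (B n) := by
  have hex : ∀ n m : ℕ, ∃ x ∈ B n \ A n, m < x := fun n m => (h n).2.exists_gt m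
  choose g hg hlt using hex
  let x : ℕ → ℕ := fun n => Nat.rec (g 0 0) (fun k r => g (k + 1) r) n
  have hx : ∀ n, x n ∈ B n \ A n := by
    rintro (_ | n)
    · exact hg _ _
    · exact hg _ _
  have hmono : StrictMono x := strictMono_nat_of_lt_succ fun n => hlt _ _
  have hAB : ∀ n m, A n ⊆ B m := fun n m =>
    (hA (le_max_left n m)).trans ((h _).1.trans (hB (le_max_right n m)))
  refine ⟨(⋃ n, A n) \ Set.range x, ((⋃ n, A n) \ Set.range x) ∪ Set.range x,
    ⟨Set.subset_union_left, ?_⟩, fun n => starSeg_mono ?_ ?_⟩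
  · refine (Set.infinite_range_of_injective hmono.injective).mono fun y hy => ⟨Or.inr hy, ?_⟩
    exact fun hy' => hy'.2 hy
  · refine ((Set.finite_Iio n).image x).subset ?_
    rintro y ⟨hy, hy'⟩
    obtain ⟨k, rfl⟩ : y ∈ Set.range x := by
      by_contra hk
      exact hy' ⟨Set.mem_iUnion.2 ⟨n, hy⟩, hk⟩
    refine ⟨k, ?_, rfl⟩
    by_contra hk
    exact (hx k).2 (hA (not_lt.1 hk) hy)
  · refine ((Set.finite_Iio n).image x).subset ?_
    rintro y ⟨hy | ⟨k, rfl⟩, hy'⟩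
    · obtain ⟨m, hm⟩ := Set.mem_iUnion.1 hy.1
      exact (hy' (hAB m n hm)).elim
    · refine ⟨k, ?_, rfl⟩
      by_contra hk
      exact hy' (hB (not_lt.1 hk) (hx k).1)

theorem almostSub_union_image_iff {A C D : Set ℕ} {f : ℕ → ℕ} (hf : Function.Injective f)
    (hfA : ∀ n, f n ∉ A) : AlmostSub (A ∪ f '' C) (A ∪ f '' D) ↔ AlmostSub C D := by
  have : (A ∪ f '' C) \ (A ∪ f '' D) = f '' (C \ D) := by
    rw [Set.image_sdiff hf]
    ext x
    simp only [Set.mem_sdiff, Set.mem_union, not_or]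
    constructor
    · rintro ⟨h₁ | h₁, h₂, h₃⟩
      · exact (h₂ h₁).elim
      · exact ⟨h₁, h₃⟩
    · rintro ⟨⟨n, hn, rfl⟩, h₃⟩
      exact ⟨Or.inr ⟨n, hn, rfl⟩, hfA n, h₃⟩
  rw [AlmostSub, this, Set.finite_image_iff hf.injOn, AlmostSub]

/-- The order of *-segments below a given *-segment contains, densely below one of its elements, a
copy of the order of all *-segments. -/
theorem IsStarSeg.exists_embedding {U : Set (Set ℕ)} (hU : IsStarSeg U) :
    ∃ e : Set (Set ℕ) → Set (Set ℕ), (∀ V, IsStarSeg V → IsStarSeg (e V) ∧ e V ⊆ U) ∧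
      (∀ V W, IsStarSeg V → IsStarSeg W → (e V ⊆ e W ↔ V ⊆ W)) ∧
      ∀ V W, IsStarSeg V → V ⊆ e W → ∃ T, IsStarSeg T ∧ e T ⊆ V := by
  obtain ⟨A, B, h, rfl⟩ := hU
  obtain ⟨f, hf, hfB, hfA⟩ : ∃ f : ℕ → ℕ, Function.Injective f ∧ (∀ n, f n ∈ B) ∧
      ∀ n, f n ∉ A :=
    let g := h.2.natEmbedding
    ⟨fun n => g n, Subtype.val_injective.comp g.injective, fun n => (g n).2.1,
      fun n => (g n).2.2⟩
  have hseg : ∀ C D, IsSeg C D → IsSeg (A ∪ f '' C) (A ∪ f '' D) := fun C D hCD =>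
    ⟨Set.union_subset_union_right _ (Set.image_mono hCD.1), fun hfin => hCD.2
      ((almostSub_union_image_iff hf hfA).1 hfin)⟩
  have hrep : ∀ V : Set (Set ℕ), ∃ p : Set ℕ × Set ℕ,
      IsStarSeg V → IsSeg p.1 p.2 ∧ V = StarSeg p.1 p.2 := by
    intro V
    by_cases hV : IsStarSeg V
    · obtain ⟨C, D, hCD, rfl⟩ := hV
      exact ⟨(C, D), fun _ => ⟨hCD, rfl⟩⟩
    · exact ⟨(∅, ∅), fun h => (hV h).elim⟩
  choose p hp using hrep
  have hle : ∀ V W, IsStarSeg V → IsStarSeg W →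
      (StarSeg (A ∪ f '' (p V).1) (A ∪ f '' (p V).2) ⊆
        StarSeg (A ∪ f '' (p W).1) (A ∪ f '' (p W).2) ↔ V ⊆ W) := by
    intro V W hV hW
    conv_rhs => rw [(hp V hV).2, (hp W hW).2]
    rw [starSeg_subset_iff (hseg _ _ (hp V hV).1), starSeg_subset_iff (hp V hV).1,
      almostSub_union_image_iff hf hfA, almostSub_union_image_iff hf hfA]
  refine ⟨fun V => StarSeg (A ∪ f '' (p V).1) (A ∪ f '' (p V).2), fun V hV =>
    ⟨⟨_, _, hseg _ _ (hp V hV).1, rfl⟩, starSeg_mono (.of_subset Set.subset_union_left)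
      (.of_subset (Set.union_subset h.1 ?_))⟩, hle, ?_⟩
  · rintro _ ⟨n, -, rfl⟩
    exact hfB n
  · rintro _ W ⟨C, D, hCD, rfl⟩ hsub
    obtain ⟨h₁, h₂⟩ := (starSeg_subset_iff hCD).1 hsub
    have hAC : AlmostSub A C := (AlmostSub.of_subset Set.subset_union_left).trans h₁
    have hDr : AlmostSub D (A ∪ Set.range f) := h₂.trans
      (.of_subset (Set.union_subset_union_right _ (Set.image_subset_range _ _)))
    have hT : IsSeg (f ⁻¹' C) (f ⁻¹' D) := by
      refine ⟨Set.preimage_mono hCD.1, fun hfin => hCD.2 ?_⟩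
      refine ((hfin.image f).union (Set.Finite.union hDr hAC)).subset fun x hx => ?_
      by_cases hxr : x ∈ Set.range f
      · obtain ⟨n, rfl⟩ := hxr
        exact Or.inl ⟨n, hx, rfl⟩
      · by_cases hxA : x ∈ A
        · exact Or.inr (Or.inr ⟨hxA, hx.2⟩)
        · exact Or.inr (Or.inl ⟨hx.1, fun h => h.elim hxA hxr⟩)
    refine ⟨StarSeg (f ⁻¹' C) (f ⁻¹' D), ⟨_, _, hT, rfl⟩, ?_⟩
    obtain ⟨hq, heq⟩ := hp _ ⟨_, _, hT, rfl⟩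
    obtain ⟨h₃, -⟩ := (starSeg_subset_iff hT).1 heq.subset
    obtain ⟨h₄, h₅⟩ := (starSeg_subset_iff hq).1 heq.symm.subset
    refine starSeg_mono (AlmostSub.trans ?_ (Set.Finite.subset
      ((almostSub_union_image_iff hf hfA).2 h₄) subset_rfl))
      (AlmostSub.trans ((almostSub_union_image_iff hf hfA).2 h₅) ?_)
    · refine Set.Finite.subset ((AlmostSub.of_subset hCD.1).trans hDr) fun x hx => ⟨hx.1, ?_⟩
      rintro (hxA | ⟨n, rfl⟩)
      · exact hx.2 (Or.inl hxA)
      · exact hx.2 (Or.inr ⟨n, hx.1, rfl⟩)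
    · refine (hAC.trans (.of_subset hCD.1)).union (.of_subset ?_)
      rintro _ ⟨n, hn, rfl⟩
      exact hn

/-- At most one member of `P` meets `U` in a *-segment. -/
def Unsplit (P : Set (Set (Set ℕ))) (U : Set (Set ℕ)) : Prop :=
  ∀ X ∈ P, ∀ Y ∈ P, IsStarSeg (X ∩ U) → IsStarSeg (Y ∩ U) → X = Y

theorem IsStarSeg.inter_of_subset {X U V : Set (Set ℕ)} (hX : IsStarSeg X) (hU : IsStarSeg U)
    (hV : IsStarSeg V) (hVX : V ⊆ X) (hVU : V ⊆ U) : IsStarSeg (X ∩ U) :=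
  hX.inter_s9 hU fun hc => hV.not_countable_s9 (hc.mono (Set.subset_inter hVX hVU))

theorem IsVPartition.exists_inter {P : Set (Set (Set ℕ))} (hP : IsVPartition P)
    {U : Set (Set ℕ)} (hU : IsStarSeg U) : ∃ X ∈ P, IsStarSeg (X ∩ U) := by
  by_cases h : U ∈ P
  · exact ⟨U, h, by rwa [Set.inter_self]⟩
  · obtain ⟨X, hX, hXU⟩ := hP.2.2 U hU h
    refine ⟨X, hX, (hP.1 X hX).inter_s9 hU ?_⟩
    rwa [Set.inter_comm]

theorem IsVPartition.unsplit_of_subset {P : Set (Set (Set ℕ))} (hP : IsVPartition P)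
    {U X : Set (Set ℕ)} (hX : X ∈ P) (hUX : U ⊆ X) : Unsplit P U := by
  have key : ∀ Y ∈ P, IsStarSeg (Y ∩ U) → Y = X := by
    intro Y hY h
    by_contra hne
    exact h.not_countable_s9
      ((hP.2.1 Y hY X hX hne).mono (Set.inter_subset_inter_right _ hUX))
  intro Y hY Z hZ h₁ h₂
  rw [key Y hY h₁, key Z hZ h₂]

theorem IsVPartition.unsplit_mono {P : Set (Set (Set ℕ))} (hP : IsVPartition P)
    {U V : Set (Set ℕ)} (hU : IsStarSeg U) (hVU : V ⊆ U) (h : Unsplit P U) : Unsplit P V := by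
  have key : ∀ X ∈ P, IsStarSeg (X ∩ V) → IsStarSeg (X ∩ U) := fun X hX hXV =>
    (hP.1 X hX).inter_of_subset hU hXV Set.inter_subset_left (Set.inter_subset_right.trans hVU)
  exact fun X hX Y hY h₁ h₂ => h X hX Y hY (key X hX h₁) (key Y hY h₂)

theorem shattering_iff {H : Set (Set (Set (Set ℕ)))} :
    Shattering H ↔ IsVMatrix H ∧ ∀ U, IsStarSeg U → ∃ P ∈ H, ¬ Unsplit P U := by
  refine and_congr_right fun hH => ⟨?_, fun h A B hAB => ?_⟩
  · rintro h _ ⟨A, B, hAB, rfl⟩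
    obtain ⟨P, hP, X, hX, Y, hY, hne, h₁, h₂, -⟩ := h A B hAB
    exact ⟨P, hP, fun hs => hne (hs X hX Y hY h₁ h₂)⟩
  · obtain ⟨P, hP, hs⟩ := h _ ⟨A, B, hAB, rfl⟩
    simp only [Unsplit, not_forall] at hs
    obtain ⟨X, hX, Y, hY, h₁, h₂, hne⟩ := hs
    refine ⟨P, hP, X, hX, Y, hY, hne, h₁, h₂, fun heq => h₁.not_countable_s9 ?_⟩
    refine ((hH P hP).2.1 X hX Y hY hne).mono (Set.subset_inter Set.inter_subset_left ?_)
    rw [heq]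
    exact Set.inter_subset_left

theorem exists_isVPartition_subset_s9 {D : Set (Set (Set ℕ))}
    (hD : ∀ U, IsStarSeg U → ∃ V ∈ D, IsStarSeg V ∧ V ⊆ U) :
    ∃ P, IsVPartition P ∧ P ⊆ D := by
  obtain ⟨P, hP⟩ := zorn_subset
    {P : Set (Set (Set ℕ)) | (∀ X ∈ P, X ∈ D ∧ IsStarSeg X) ∧ P.Pairwise StarDisjoint} (by
      intro c hc hchain
      refine ⟨⋃₀ c, ⟨?_, ?_⟩, fun s hs => Set.subset_sUnion_of_mem hs⟩
      · rintro X ⟨s, hs, hX⟩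
        exact (hc hs).1 X hX
      · exact (Set.pairwise_sUnion hchain.directedOn).2 fun s hs => (hc hs).2)
  refine ⟨P, ⟨fun X hX => (hP.prop.1 X hX).2, hP.prop.2, fun R hR hRP => ?_⟩,
    fun X hX => (hP.prop.1 X hX).1⟩
  obtain ⟨V, hVD, hV, hVR⟩ := hD R hR
  by_contra! hcon
  have hdisj : ∀ X ∈ P, StarDisjoint V X := fun X hX =>
    (hcon X hX).mono (Set.inter_subset_inter_left _ hVR)
  have hVP : V ∉ P := fun h => by
    have := hdisj V h
    rw [StarDisjoint, Set.inter_self] at this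
    exact hV.not_countable_s9 this
  refine hVP (hP.le_of_ge (y := insert V P) ⟨?_, ?_⟩ (Set.subset_insert _ _)
    (Set.mem_insert _ _))
  · rintro X (rfl | hX)
    · exact ⟨hVD, hV⟩
    · exact hP.prop.1 X hX
  · refine hP.prop.2.insert fun X hX _ => ⟨hdisj X hX, ?_⟩
    rw [StarDisjoint, Set.inter_comm]
    exact hdisj X hX

theorem IsStarSeg.exists_not_unsplit {U : Set (Set ℕ)} (hU : IsStarSeg U) :
    ∃ P, IsVPartition P ∧ ¬ Unsplit P U := by
  obtain ⟨V, W, hV, hW, hVU, hWU, hVW⟩ := hU.exists_disjoint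
  obtain ⟨P, hP, hPD⟩ := exists_isVPartition_subset_s9 (D := {X | X ⊆ V ∨ (X ∩ V).Countable}) (by
    intro X hX
    by_cases h : (X ∩ V).Countable
    · exact ⟨X, Or.inr h, hX, subset_rfl⟩
    · exact ⟨X ∩ V, Or.inl Set.inter_subset_right, hX.inter_s9 hV h, Set.inter_subset_left⟩)
  refine ⟨P, hP, fun hs => ?_⟩
  obtain ⟨X, hX, hXV⟩ := hP.exists_inter hV
  obtain ⟨Y, hY, hYW⟩ := hP.exists_inter hW
  have hXU := (hP.1 X hX).inter_of_subset hU hXV Set.inter_subset_left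
    (Set.inter_subset_right.trans hVU)
  have hYU := (hP.1 Y hY).inter_of_subset hU hYW Set.inter_subset_left
    (Set.inter_subset_right.trans hWU)
  obtain rfl := hs X hX Y hY hXU hYU
  rcases hPD hX with h | h
  · exact hYW.not_countable_s9 (hVW.mono (Set.inter_subset_inter_left _ h))
  · exact hXV.not_countable_s9 h

theorem kappaV_le {H : Set (Set (Set (Set ℕ)))} (hH : Shattering H) : kappaV ≤ #H :=
  csInf_le' ⟨H, hH, rfl⟩

theorem exists_shattering_mk_eq : ∃ H, Shattering H ∧ #H = kappaV := by
  refine csInf_mem (s := {c : Cardinal | ∃ H : Set (Set (Set (Set ℕ))), Shattering H ∧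
    Cardinal.mk ↥H = c}) ⟨_, {P | IsVPartition P}, shattering_iff.2 ⟨fun _ h => h, ?_⟩, rfl⟩
  exact fun U hU => hU.exists_not_unsplit

theorem exists_unsplit_of_mk_lt {H : Set (Set (Set (Set ℕ)))} (hH : IsVMatrix H)
    (hlt : #H < kappaV) : ∃ U, IsStarSeg U ∧ ∀ P ∈ H, Unsplit P U := by
  by_contra! h
  exact hlt.not_ge (kappaV_le (shattering_iff.2 ⟨hH, h⟩))

theorem exists_unsplit_subset_of_mk_lt {H : Set (Set (Set (Set ℕ)))} (hH : IsVMatrix H)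
    (hlt : #H < kappaV) {U : Set (Set ℕ)} (hU : IsStarSeg U) :
    ∃ V, IsStarSeg V ∧ V ⊆ U ∧ ∀ P ∈ H, Unsplit P V := by
  obtain ⟨e, he, hle, hdense⟩ := hU.exists_embedding
  have hdense' : ∀ V W, IsStarSeg V → IsStarSeg W → V ⊆ e W →
      ∃ T, IsStarSeg T ∧ T ⊆ W ∧ e T ⊆ V := fun V W hV hW hVW => by
    obtain ⟨T, hT, hTV⟩ := hdense V W hV hVW
    exact ⟨T, hT, (hle T W hT hW).1 (hTV.trans hVW), hTV⟩
  have hpull : ∀ P : H, ∃ Q, IsVPartition Q ∧ Q ⊆ {V | Unsplit P (e V)} := by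
    rintro ⟨P, hP⟩
    refine exists_isVPartition_subset_s9 fun V hV => ?_
    obtain ⟨X, hX, hXV⟩ := (hH P hP).exists_inter (he V hV).1
    obtain ⟨T, hT, hTV, heT⟩ := hdense' _ V hXV hV Set.inter_subset_right
    exact ⟨T, (hH P hP).unsplit_of_subset hX (heT.trans Set.inter_subset_left), hT, hTV⟩
  choose Q hQ hQe using hpull
  obtain ⟨S, hS, hSQ⟩ := exists_unsplit_of_mk_lt (H := Set.range Q)
    (by rintro _ ⟨P, rfl⟩; exact hQ P) (Cardinal.mk_range_le.trans_lt hlt)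
  refine ⟨e S, (he S hS).1, (he S hS).2, fun P hP X hX Y hY h₁ h₂ => ?_⟩
  have key : ∀ X ∈ P, IsStarSeg (X ∩ e S) →
      ∃ Z ∈ Q ⟨P, hP⟩, IsStarSeg (Z ∩ S) ∧ IsStarSeg (X ∩ e Z) := by
    intro X hX hXS
    obtain ⟨T, hT, hTS, heT⟩ := hdense' _ S hXS hS Set.inter_subset_right
    obtain ⟨Z, hZ, hZT⟩ := (hQ ⟨P, hP⟩).exists_inter hT
    have hZs := (hQ ⟨P, hP⟩).1 Z hZ
    refine ⟨Z, hZ, hZs.inter_of_subset hS hZT Set.inter_subset_left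
      (Set.inter_subset_right.trans hTS), ((hH P hP).1 X hX).inter_of_subset (he Z hZs).1
      (he _ hZT).1 ?_ ((hle _ _ hZT hZs).2 Set.inter_subset_left)⟩
    exact (((hle _ _ hZT hT).2 Set.inter_subset_right).trans heT).trans Set.inter_subset_left
  obtain ⟨Z, hZ, hZS, hXZ⟩ := key X hX h₁
  obtain ⟨Z', hZ', hZS', hYZ⟩ := key Y hY h₂
  obtain rfl := hSQ _ ⟨⟨P, hP⟩, rfl⟩ Z hZ Z' hZ' hZS hZS'
  exact hQe ⟨P, hP⟩ hZ X hX Y hY hXZ hYZ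

theorem not_shattering_of_countable {H : Set (Set (Set (Set ℕ)))} (hc : H.Countable) :
    ¬ Shattering H := by
  rw [shattering_iff]
  rintro ⟨hH, hs⟩
  have huniv : IsSeg ∅ Set.univ := ⟨Set.empty_subset _, by simpa using Set.infinite_univ⟩
  have hne : H.Nonempty := by
    obtain ⟨P, hP, -⟩ := hs _ ⟨_, _, huniv, rfl⟩
    exact ⟨P, hP⟩
  obtain ⟨P, rfl⟩ := hc.exists_eq_range hne
  have hstep : ∀ (n : ℕ) (p : {p : Set ℕ × Set ℕ // IsSeg p.1 p.2}),
      ∃ q : {p : Set ℕ × Set ℕ // IsSeg p.1 p.2}, p.1.1 ⊆ q.1.1 ∧ q.1.2 ⊆ p.1.2 ∧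
        Unsplit (P n) (StarSeg q.1.1 q.1.2) := by
    rintro n ⟨⟨A, B⟩, hAB⟩
    have hPn : IsVPartition (P n) := hH _ ⟨n, rfl⟩
    obtain ⟨X, hX, hXA⟩ := hPn.exists_inter ⟨A, B, hAB, rfl⟩
    obtain ⟨C, D, hCD, rfl⟩ := hPn.1 X hX
    rw [Set.inter_comm] at hXA
    obtain ⟨A', B', hA, hB, h', heq⟩ :=
      exists_isSeg_of_inter_not_countable hAB hXA.not_countable_s9
    exact ⟨⟨(A', B'), h'⟩, hA, hB,
      hPn.unsplit_of_subset hX (heq.subset.trans Set.inter_subset_right)⟩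
  choose g hgA hgB hgP using hstep
  let s : ℕ → {p : Set ℕ × Set ℕ // IsSeg p.1 p.2} :=
    fun n => Nat.rec ⟨(∅, Set.univ), huniv⟩ (fun k p => g k p) n
  obtain ⟨C, D, hCD, hsub⟩ := exists_isSeg_of_monotone
    (A := fun n => (s n).1.1) (B := fun n => (s n).1.2)
    (monotone_nat_of_le_succ fun n => hgA n (s n))
    (antitone_nat_of_succ_le fun n => hgB n (s n)) fun n => (s n).2
  obtain ⟨_, ⟨n, rfl⟩, hn⟩ := hs _ ⟨C, D, hCD, rfl⟩
  exact hn ((hH _ ⟨n, rfl⟩).unsplit_mono ⟨_, _, (s (n + 1)).2, rfl⟩ (hsub (n + 1))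
    (hgP n (s n)))

theorem aleph_one_le_kappaV : ℵ₁ ≤ kappaV := by
  obtain ⟨H, hH, hcard⟩ := exists_shattering_mk_eq
  rw [← hcard, ← not_lt, Cardinal.lt_aleph_one_iff, Cardinal.le_aleph0_iff_set_countable]
  exact fun hc => not_shattering_of_countable hc hH

/-- If a shattering v-matrix is a union of small pieces, there are at least `κ(v)` pieces. -/
theorem kappaV_le_of_cover {H : Set (Set (Set (Set ℕ)))} (hH : Shattering H) {ι : Type}
    (K : ι → Set (Set (Set (Set ℕ)))) (hKH : ∀ i, K i ⊆ H) (hcover : ∀ P ∈ H, ∃ i, P ∈ K i)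
    (hlt : ∀ i, #(K i) < kappaV) : kappaV ≤ #ι := by
  have hQ : ∀ i, ∃ Q, IsVPartition Q ∧ Q ⊆ {V | ∀ P ∈ K i, Unsplit P V} := fun i =>
    exists_isVPartition_subset_s9 fun U hU => by
      obtain ⟨V, hV, hVU, h⟩ :=
        exists_unsplit_subset_of_mk_lt (fun P hP => hH.1 P (hKH i hP)) (hlt i) hU
      exact ⟨V, h, hV, hVU⟩
  choose Q hQ hQK using hQ
  refine (kappaV_le (H := Set.range Q) (shattering_iff.2 ⟨?_, fun U hU => ?_⟩)).trans
    Cardinal.mk_range_le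
  · rintro _ ⟨i, rfl⟩
    exact hQ i
  · obtain ⟨P, hP, hs⟩ := (shattering_iff.1 hH).2 U hU
    obtain ⟨i, hi⟩ := hcover P hP
    refine ⟨_, ⟨i, rfl⟩, fun hu => hs fun X hX Y hY h₁ h₂ => ?_⟩
    have key : ∀ X ∈ P, IsStarSeg (X ∩ U) →
        ∃ Z ∈ Q i, IsStarSeg (Z ∩ U) ∧ IsStarSeg (X ∩ Z) := by
      intro X hX hXU
      obtain ⟨Z, hZ, hZX⟩ := (hQ i).exists_inter hXU
      have hZs := (hQ i).1 Z hZ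
      exact ⟨Z, hZ, hZs.inter_of_subset hU hZX Set.inter_subset_left
        (Set.inter_subset_right.trans Set.inter_subset_right),
        ((hH.1 P hP).1 X hX).inter_of_subset hZs hZX
        (Set.inter_subset_right.trans Set.inter_subset_left) Set.inter_subset_left⟩
    obtain ⟨Z, hZ, hZU, hXZ⟩ := key X hX h₁
    obtain ⟨Z', hZ', hZU', hYZ⟩ := key Y hY h₂
    obtain rfl := hu Z hZ Z' hZ' hZU hZU'
    exact hQK i hZ P hi X hX Y hY hXZ hYZ

/-- Theorem 10 (part): `κ(v)` is an uncountable regular cardinal. -/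
theorem kappaV_uncountable_and_regular :
    Cardinal.aleph 1 ≤ kappaV ∧ kappaV.IsRegular := by
  have hω : ℵ₀ ≤ kappaV := (Cardinal.aleph0_le_aleph 1).trans aleph_one_le_kappaV
  refine ⟨aleph_one_le_kappaV, hω, ?_⟩
  obtain ⟨H, hH, hcard⟩ := exists_shattering_mk_eq
  obtain ⟨r⟩ : Nonempty (H ≃ kappaV.ord.ToType) := Cardinal.eq.1 (by simp [hcard])
  obtain ⟨S, hS, hScard⟩ := Order.exists_cof_eq kappaV.ord.ToType
  rw [Ordinal.cof_toType] at hScard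
  rw [← hScard]
  refine kappaV_le_of_cover hH (fun i : S => (↑) '' (r ⁻¹' Set.Iic (i : kappaV.ord.ToType)))
    ?_ ?_ ?_
  · rintro i _ ⟨P, -, rfl⟩
    exact P.2
  · intro P hP
    obtain ⟨b, hb, hle⟩ := hS (r ⟨P, hP⟩)
    exact ⟨⟨b, hb⟩, ⟨P, hP⟩, hle, rfl⟩
  · intro i
    have h₁ : #(r ⁻¹' Set.Iic (i : kappaV.ord.ToType)) ≤ #(Set.Iic (i : kappaV.ord.ToType)) :=
      Cardinal.mk_preimage_of_injective _ _ r.injective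
    refine (Cardinal.mk_image_le.trans h₁).trans_lt ?_
    rw [← Set.Iio_insert]
    exact Cardinal.mk_insert_le.trans_lt (Cardinal.add_lt_of_lt hω
      (Cardinal.mk_Iio_lt _ (by simp) |>.trans_eq (by simp)) (Cardinal.one_lt_aleph0.trans_le hω))
end
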